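/- There exists a topological inverse monoid S (a Hausdorff topological space with continuous multiplication and inversion) containing an inverse submonoid isomorphic to the 2-generated polycyclic monoid P_2 that is a proper, dense subset of S and is discrete in the subspace topology. Consequently, the polycyclic monoid P_2 with the discrete topology is not H-closed in the class of topological inverse semigroups. -/

import Mathlib

universe u v

/-- An inverse semigroup: every element has a unique (von Neumann) inverse. -/
class InverseSemigroup (S : Type u) extends Semigroup S, Inv S where
  mul_inv_mul : ∀ a : S, a * a⁻¹ * a = a
  inv_mul_inv : ∀ a : S, a⁻¹ * a * a⁻¹ = a⁻¹
  inv_unique : ∀ a b : S, a * b * a = a → b * a * b = b → b = a⁻¹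

/-- The λ-polycyclic monoid over the index type `ι` (of cardinality λ), realized as
`(M_λ × M_λ) ∪ {0}` where `M_λ = FreeMonoid ι` is the free monoid on λ generators;
the pair `(a, b)` encodes the element `a⁻¹b` and `none` is the zero. -/
abbrev PolyMon (ι : Type u) : Type u := Option (FreeMonoid ι × FreeMonoid ι)

/-- The nonzero element `a⁻¹b` of the polycyclic monoid. -/
def polyEl {ι : Type u} (a b : FreeMonoid ι) : PolyMon ι := some (a, b)

instance {ι : Type u} : Zero (PolyMon ι) := ⟨none⟩

instance {ι : Type u} : One (PolyMon ι) := ⟨polyEl 1 1⟩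

open Classical in
/-- Multiplication of the polycyclic monoid:
`a⁻¹b · c⁻¹d = (c₁a)⁻¹d` if `c = c₁b`; `= a⁻¹(b₁d)` if `b = b₁c`; `= 0` otherwise,
and `0` is a two-sided zero. -/
noncomputable def polyMul {ι : Type u} (x y : PolyMon ι) : PolyMon ι :=
  Option.bind x fun p => Option.bind y fun q =>
    if h : ∃ c₁ : FreeMonoid ι, q.1 = c₁ * p.2 then some (Classical.choose h * p.1, q.2)
    else if h' : ∃ b₁ : FreeMonoid ι, p.2 = b₁ * q.1 then some (p.1, Classical.choose h' * q.2)
    else none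

noncomputable instance {ι : Type u} : Mul (PolyMon ι) := ⟨polyMul⟩

/-- Inversion of the polycyclic monoid: `(a⁻¹b)⁻¹ = b⁻¹a` and `0⁻¹ = 0`. -/
instance {ι : Type u} : Inv (PolyMon ι) :=
  ⟨fun x => Option.map (fun p => (p.2, p.1)) x⟩

/-- A topological magma `S` is H-closed in the class of topological inverse semigroups:
whenever `S` is embedded topologically and multiplicatively into a Hausdorff topological
inverse semigroup, its image is closed. -/
def IsHClosedTIS (S : Type u) [Mul S] [TopologicalSpace S] : Prop :=
  ∀ (T : Type v) [InverseSemigroup T] [TopologicalSpace T] [T2Space T]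
    [ContinuousMul T] [ContinuousInv T] (f : S → T),
    Function.Injective f → Topology.IsInducing f →
    (∀ x y : S, f (x * y) = f x * f y) → IsClosed (Set.range f)

/-- `S` is a topological inverse monoid containing the polycyclic monoid `P₂` as a proper,
dense, discrete inverse submonoid: `S` is Hausdorff with continuous multiplication and
inversion, is an inverse monoid, and there is a multiplicative, inversion- and
unit-preserving injection of `P₂` into `S` whose range is proper, dense, and consists of
points isolated in the subspace topology. -/
def ContainsDenseDiscreteP2 (S : Type u) [Monoid S] [Inv S] [TopologicalSpace S] : Prop :=
  T2Space S ∧ ContinuousMul S ∧ ContinuousInv S ∧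
  (∀ a : S, a * a⁻¹ * a = a) ∧ (∀ a : S, a⁻¹ * a * a⁻¹ = a⁻¹) ∧
  (∀ a b : S, a * b * a = a → b * a * b = b → b = a⁻¹) ∧
  ∃ f : PolyMon (Fin 2) → S,
    Function.Injective f ∧
    (∀ x y : PolyMon (Fin 2), f (x * y) = f x * f y) ∧
    (∀ x : PolyMon (Fin 2), f x⁻¹ = (f x)⁻¹) ∧
    f 1 = 1 ∧
    Set.range f ≠ Set.univ ∧
    Dense (Set.range f) ∧
    (∀ y ∈ Set.range f, ∃ U : Set S, IsOpen U ∧ U ∩ Set.range f = {y})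

open Filter Topology

/-- The action of a binary word on `ℕ`: it appends the word to a binary expansion. -/
def wordAct (w : FreeMonoid (Fin 2)) (k : ℕ) : ℕ :=
  w.toList.foldl (fun k x => 2 * k + (x : ℕ)) k

theorem wordAct_one (k : ℕ) : wordAct 1 k = k := rfl

theorem wordAct_of_mul (x : Fin 2) (w : FreeMonoid (Fin 2)) (k : ℕ) :
    wordAct (FreeMonoid.of x * w) k = wordAct w (2 * k + x) := rfl

theorem wordAct_mul (v w : FreeMonoid (Fin 2)) (k : ℕ) :
    wordAct (v * w) k = wordAct w (wordAct v k) := by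
  simp [wordAct, FreeMonoid.toList_mul, List.foldl_append]

theorem wordAct_eq (w : FreeMonoid (Fin 2)) (k : ℕ) :
    wordAct w k = 2 ^ w.length * k + wordAct w 0 := by
  induction w using FreeMonoid.inductionOn' generalizing k with
  | one => simp [wordAct_one]
  | of_mul x w ih =>
    rw [wordAct_of_mul, wordAct_of_mul, ih, ih (2 * 0 + x), FreeMonoid.length_mul,
      FreeMonoid.length_of]
    ring

theorem wordAct_injective (w : FreeMonoid (Fin 2)) : Function.Injective (wordAct w) := by
  intro k l h
  rw [wordAct_eq w k, wordAct_eq w l] at h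
  simpa using h

theorem eq_of_wordAct_eq {v w : FreeMonoid (Fin 2)} {k l : ℕ} (hlen : v.length = w.length)
    (h : wordAct v k = wordAct w l) : v = w := by
  induction v using FreeMonoid.inductionOn' generalizing w k l with
  | one => exact (FreeMonoid.length_eq_zero.1 hlen.symm).symm
  | of_mul x v ih =>
    induction w using FreeMonoid.inductionOn' with
    | one => simp [FreeMonoid.length_mul] at hlen
    | of_mul y w _ =>
      rw [wordAct_of_mul, wordAct_of_mul] at h
      have hvw : v = w := ih (by simpa [FreeMonoid.length_mul] using hlen) h
      subst hvw
      have h2 := wordAct_injective v h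
      have hxy : x = y := by ext; omega
      rw [hxy]

theorem exists_eq_mul_of_wordAct_eq {v w : FreeMonoid (Fin 2)} {k l : ℕ}
    (hlen : v.length ≤ w.length) (h : wordAct v k = wordAct w l) : ∃ u, w = u * v := by
  obtain ⟨u, v', rfl, hv'⟩ : ∃ u v', w = u * v' ∧ v'.length = v.length :=
    ⟨FreeMonoid.ofList (w.toList.take (w.length - v.length)),
      FreeMonoid.ofList (w.toList.drop (w.length - v.length)),
      by rw [← FreeMonoid.ofList_append, List.take_append_drop]; rfl, by
      change (w.toList.drop (w.length - v.length)).length = v.length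
      rw [List.length_drop]
      change w.length - _ = _
      omega⟩
  rw [wordAct_mul] at h
  exact ⟨u, by rw [eq_of_wordAct_eq hv'.symm h]⟩

theorem exists_wordAct_eq (n i : ℕ) :
    ∃ w : FreeMonoid (Fin 2), w.length = n ∧ ∃ k, wordAct w k = i := by
  induction n with
  | zero => exact ⟨1, rfl, i, rfl⟩
  | succ n ih =>
    obtain ⟨w, hw, k, hk⟩ := ih
    refine ⟨FreeMonoid.of ⟨k % 2, Nat.mod_lt _ two_pos⟩ * w, ?_, k / 2, ?_⟩
    · rw [FreeMonoid.length_mul, FreeMonoid.length_of, hw, add_comm]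
    · rw [wordAct_of_mul, ← hk]
      congr 1
      exact Nat.div_add_mod k 2

theorem exists_wordAct_zero_eq {n i : ℕ} (h : i < 2 ^ n) :
    ∃ w : FreeMonoid (Fin 2), w.length = n ∧ wordAct w 0 = i := by
  obtain ⟨w, hw, k, hk⟩ := exists_wordAct_eq n i
  obtain rfl : k = 0 := by
    by_contra hk0
    have := wordAct_eq w k
    have : 2 ^ n * 1 ≤ 2 ^ n * k := Nat.mul_le_mul_left _ (Nat.pos_of_ne_zero hk0)
    rw [hw] at *
    omega
  exact ⟨w, hw, hk⟩

theorem eq_of_range_wordAct {v w : FreeMonoid (Fin 2)}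
    (h : Set.range (wordAct v) = Set.range (wordAct w)) : v = w := by
  have key : ∀ {v w : FreeMonoid (Fin 2)}, Set.range (wordAct v) ⊆ Set.range (wordAct w) →
      w.length ≤ v.length := by
    intro v w h
    obtain ⟨k, hk⟩ := h ⟨0, rfl⟩
    obtain ⟨l, hl⟩ := h ⟨1, rfl⟩
    rw [wordAct_eq w k] at hk
    rw [wordAct_eq w l, wordAct_eq v 1] at hl
    have hd : 2 ^ w.length * l = 2 ^ w.length * k + 2 ^ v.length := by omega
    have hd' : 2 ^ w.length ∣ 2 ^ v.length :=
      (Nat.dvd_add_right (Dvd.intro k rfl)).1 (hd ▸ Dvd.intro l rfl)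
    exact (Nat.pow_dvd_pow_iff_le_right (le_refl 2)).1 hd'
  obtain ⟨k, hk⟩ := h.subset ⟨0, rfl⟩
  exact eq_of_wordAct_eq (le_antisymm (key h.superset) (key h.subset)) hk.symm

theorem PEquiv.ext_mem {α β : Type*} {f g : α ≃. β} (h : ∀ x y, y ∈ f x ↔ y ∈ g x) : f = g :=
  PEquiv.ext fun x => Option.ext (h x)

/-- The total injection `wordAct w`, as a partial bijection. -/
noncomputable def wordEquiv (w : FreeMonoid (Fin 2)) : ℕ ≃. ℕ where
  toFun k := some (wordAct w k)
  invFun := Function.partialInv (wordAct w)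
  inv k l := by
    have := (wordAct_injective w).isPartialInv k l
    simpa [Option.mem_def] using this

/-- The representation of `P₂` by partial bijections of `ℕ`. -/
noncomputable def polyRep : PolyMon (Fin 2) → (ℕ ≃. ℕ)
  | none => ⊥
  | some p => (wordEquiv p.1).symm.trans (wordEquiv p.2)

theorem mem_polyRep {a b : FreeMonoid (Fin 2)} {x y : ℕ} :
    y ∈ polyRep (polyEl a b) x ↔ ∃ k, wordAct a k = x ∧ wordAct b k = y := by
  simp only [polyRep, polyEl, PEquiv.mem_trans, PEquiv.mem_iff_mem]
  simp [wordEquiv]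

theorem polyRep_inv (p : PolyMon (Fin 2)) : polyRep p⁻¹ = (polyRep p).symm := by
  rcases p with _ | ⟨a, b⟩
  · rfl
  · change (wordEquiv b).symm.trans (wordEquiv a) = _
    rw [polyRep, PEquiv.symm_trans_rev]
    rfl

theorem polyRep_one : polyRep 1 = PEquiv.refl ℕ := by
  refine PEquiv.ext_mem fun x y => ?_
  change y ∈ polyRep (polyEl 1 1) x ↔ _
  rw [mem_polyRep]
  simp [wordAct_one]

theorem polyEl_mul_of_left (a b c₁ d : FreeMonoid (Fin 2)) :
    polyEl a b * polyEl (c₁ * b) d = polyEl (c₁ * a) d := by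
  have h : ∃ c₁', c₁ * b = c₁' * b := ⟨c₁, rfl⟩
  have hc : Classical.choose h = c₁ := (mul_right_cancel h.choose_spec).symm
  change polyMul (some (a, b)) (some (c₁ * b, d)) = some (c₁ * a, d)
  simp only [polyMul, Option.bind_some]
  rw [dif_pos h, hc]

theorem polyEl_mul_of_right (a b₁ c d : FreeMonoid (Fin 2)) :
    polyEl a (b₁ * c) * polyEl c d = polyEl a (b₁ * d) := by
  by_cases h : ∃ c₁, c = c₁ * (b₁ * c)
  · obtain ⟨c₁, hc⟩ := h
    have hlen := congrArg FreeMonoid.length hc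
    simp only [FreeMonoid.length_mul] at hlen
    obtain rfl : b₁ = 1 := FreeMonoid.length_eq_zero.1 (by omega)
    simpa using polyEl_mul_of_left a c 1 d
  · have h' : ∃ b₁', b₁ * c = b₁' * c := ⟨b₁, rfl⟩
    have hb : Classical.choose h' = b₁ := (mul_right_cancel h'.choose_spec).symm
    change polyMul (some (a, b₁ * c)) (some (c, d)) = some (a, b₁ * d)
    simp only [polyMul, Option.bind_some]
    rw [dif_neg h, dif_pos h', hb]

theorem polyEl_mul_eq_zero {a b c d : FreeMonoid (Fin 2)} (h : ¬ ∃ c₁, c = c₁ * b)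
    (h' : ¬ ∃ b₁, b = b₁ * c) : polyEl a b * polyEl c d = 0 := by
  change polyMul (some (a, b)) (some (c, d)) = none
  simp only [polyMul, Option.bind_some]
  rw [dif_neg h, dif_neg h']

theorem polyRep_mul (p q : PolyMon (Fin 2)) :
    polyRep (p * q) = (polyRep p).trans (polyRep q) := by
  rcases p with _ | ⟨a, b⟩
  · exact (PEquiv.bot_trans _).symm
  rcases q with _ | ⟨c, d⟩
  · exact (PEquiv.trans_bot _).symm
  change polyRep (polyEl a b * polyEl c d) = (polyRep (polyEl a b)).trans (polyRep (polyEl c d))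
  refine PEquiv.ext_mem fun x y => ?_
  rw [PEquiv.mem_trans]
  simp only [mem_polyRep]
  by_cases h : ∃ c₁, c = c₁ * b
  · obtain ⟨c₁, rfl⟩ := h
    rw [polyEl_mul_of_left, mem_polyRep]
    constructor
    · rintro ⟨k, rfl, rfl⟩
      exact ⟨_, ⟨wordAct c₁ k, (wordAct_mul _ _ _).symm, rfl⟩, k, wordAct_mul _ _ _, rfl⟩
    · rintro ⟨z, ⟨k, rfl, rfl⟩, l, hl, rfl⟩
      rw [wordAct_mul] at hl
      exact ⟨l, by rw [wordAct_mul, wordAct_injective b hl], rfl⟩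
  by_cases h' : ∃ b₁, b = b₁ * c
  · obtain ⟨b₁, rfl⟩ := h'
    rw [polyEl_mul_of_right, mem_polyRep]
    constructor
    · rintro ⟨k, rfl, rfl⟩
      exact ⟨_, ⟨k, rfl, rfl⟩, wordAct b₁ k, (wordAct_mul _ _ _).symm, (wordAct_mul _ _ _).symm⟩
    · rintro ⟨z, ⟨k, rfl, rfl⟩, l, hl, rfl⟩
      rw [wordAct_mul] at hl
      exact ⟨k, rfl, by rw [wordAct_mul, wordAct_injective c hl]⟩
  · rw [polyEl_mul_eq_zero h h']
    refine iff_of_false (by simp [polyRep]) ?_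
    rintro ⟨z, ⟨k, rfl, rfl⟩, l, hl, rfl⟩
    rcases le_total b.length c.length with hbc | hbc
    · exact h (exists_eq_mul_of_wordAct_eq hbc hl.symm)
    · exact h' (exists_eq_mul_of_wordAct_eq hbc hl)

/-- The domain of a partial bijection. -/
def PEquiv.domain {α β : Type*} (f : α ≃. β) : Set α := {x | ∃ y, y ∈ f x}

theorem PEquiv.mem_domain {α β : Type*} {f : α ≃. β} {x : α} : x ∈ f.domain ↔ ∃ y, y ∈ f x :=
  Iff.rfl

theorem domain_polyRep (a b : FreeMonoid (Fin 2)) :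
    (polyRep (polyEl a b)).domain = Set.range (wordAct a) := by
  ext x
  simp only [PEquiv.mem_domain, mem_polyRep, Set.mem_range]
  exact ⟨fun ⟨_, k, hk, _⟩ => ⟨k, hk⟩, fun ⟨k, hk⟩ => ⟨_, k, hk, rfl⟩⟩

theorem domain_polyRep_symm (a b : FreeMonoid (Fin 2)) :
    (polyRep (polyEl a b)).symm.domain = Set.range (wordAct b) := by
  rw [← polyRep_inv]
  exact domain_polyRep b a

theorem polyRep_polyEl_ne_bot (a b : FreeMonoid (Fin 2)) : polyRep (polyEl a b) ≠ ⊥ := by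
  intro h
  have : wordAct b 0 ∈ polyRep (polyEl a b) (wordAct a 0) := mem_polyRep.2 ⟨0, rfl, rfl⟩
  simp [h] at this

theorem polyRep_injective : Function.Injective polyRep := by
  rintro (_ | ⟨a, b⟩) (_ | ⟨c, d⟩) h
  · rfl
  · exact (polyRep_polyEl_ne_bot c d h.symm).elim
  · exact (polyRep_polyEl_ne_bot a b h).elim
  · change polyRep (polyEl a b) = polyRep (polyEl c d) at h
    have h₁ := congrArg PEquiv.domain h
    have h₂ := congrArg (fun f => f.symm.domain) h
    simp only [domain_polyRep, domain_polyRep_symm] at h₁ h₂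
    rw [eq_of_range_wordAct h₁, eq_of_range_wordAct h₂]

theorem polyRep_ne_single (p : PolyMon (Fin 2)) (i j : ℕ) : polyRep p ≠ PEquiv.single i j := by
  rcases p with _ | ⟨a, b⟩
  · intro h
    have : j ∈ PEquiv.single i j i := by simp
    rw [← h] at this
    simp [polyRep] at this
  · intro h
    have key : ∀ k, wordAct a k = i := fun k => by
      have : wordAct b k ∈ polyRep (polyEl a b) (wordAct a k) := mem_polyRep.2 ⟨k, rfl, rfl⟩
      rw [polyEl, h, PEquiv.mem_single_iff] at this
      exact this.1
    exact zero_ne_one (wordAct_injective a ((key 0).trans (key 1).symm))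

/-- A property of sets of natural numbers shared by singletons and residue classes modulo powers
of two. -/
structure IsDyadic (A : Set ℕ) : Prop where
  mem_of_modEq : ∀ {j l q : ℕ}, j ∈ A → j + 2 ^ q ∈ A → l ≡ j [MOD 2 ^ q] → l ∈ A
  modEq_of_notMem : ∀ {j l q : ℕ}, j ∈ A → j + 2 ^ q ∉ A → l ∈ A → l ≡ j [MOD 2 ^ (q + 1)]

theorem isDyadic_empty : IsDyadic ∅ := ⟨by simp, by simp⟩

theorem isDyadic_singleton (i : ℕ) : IsDyadic {i} := by
  refine ⟨fun {j l q} hj hq _ => ?_, fun {j l q} hj _ hl => ?_⟩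
  · have := Nat.two_pow_pos q
    simp only [Set.mem_singleton_iff] at hj hq
    omega
  · simp only [Set.mem_singleton_iff] at hj hl
    rw [hj, hl]

theorem wordAct_lt (w : FreeMonoid (Fin 2)) (k : ℕ) : wordAct w k < 2 ^ w.length * (k + 1) := by
  induction w using FreeMonoid.inductionOn' generalizing k with
  | one => simp [wordAct_one]
  | of_mul x w ih =>
    rw [wordAct_of_mul, FreeMonoid.length_mul, FreeMonoid.length_of]
    calc wordAct w (2 * k + x) < 2 ^ w.length * (2 * k + x + 1) := ih _
      _ ≤ 2 ^ w.length * (2 * (k + 1)) := Nat.mul_le_mul_left _ (by omega)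
      _ = 2 ^ (1 + w.length) * (k + 1) := by ring

theorem mem_range_wordAct {w : FreeMonoid (Fin 2)} {x : ℕ} :
    x ∈ Set.range (wordAct w) ↔ x ≡ wordAct w 0 [MOD 2 ^ w.length] := by
  constructor
  · rintro ⟨k, rfl⟩
    rw [wordAct_eq w k, Nat.ModEq, Nat.mul_add_mod]
  · intro h
    have hlt : wordAct w 0 < 2 ^ w.length := by simpa using wordAct_lt w 0
    rw [Nat.ModEq, Nat.mod_eq_of_lt hlt] at h
    exact ⟨x / 2 ^ w.length, by rw [wordAct_eq, ← h, Nat.div_add_mod]⟩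

theorem isDyadic_range_wordAct (w : FreeMonoid (Fin 2)) : IsDyadic (Set.range (wordAct w)) := by
  refine ⟨fun {j l q} hj hq hl => ?_, fun {j l q} hj hq hl => ?_⟩
  · rw [mem_range_wordAct] at *
    have hd : 2 ^ w.length ∣ 2 ^ q :=
      (Nat.modEq_zero_iff_dvd).1 (Nat.ModEq.add_left_cancel' j (hq.trans hj.symm))
    exact (hl.of_dvd hd).trans hj
  · rw [mem_range_wordAct] at *
    rcases le_or_gt w.length q with h | h
    · refine (hq ?_).elim
      have : 2 ^ q ≡ 0 [MOD 2 ^ w.length] := Nat.modEq_zero_iff_dvd.2 (pow_dvd_pow 2 h)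
      exact (this.add_left j).trans hj
    · exact (hl.trans hj.symm).of_dvd (pow_dvd_pow 2 h)

theorem IsDyadic.exists_separation {A B : Set ℕ} (hA : IsDyadic A) (hB : IsDyadic B)
    {j l : ℕ} (hj : j ∈ A) (hl : l ∈ B) (hAB : Disjoint A B) :
    ∃ q, ¬ j ≡ l [MOD 2 ^ (q + 1)] ∧ j + 2 ^ q ∉ A ∧ l + 2 ^ q ∉ B := by
  classical
  have hjl : j ≠ l := fun h => Set.disjoint_left.1 hAB hj (h ▸ hl)
  have hex : ∃ r, ¬ j ≡ l [MOD 2 ^ r] := by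
    refine ⟨j + l, fun h => hjl (h.eq_of_lt_of_lt ?_ ?_)⟩
    · exact lt_of_le_of_lt (Nat.le_add_right j l) Nat.lt_two_pow_self
    · exact lt_of_le_of_lt (Nat.le_add_left l j) Nat.lt_two_pow_self
  obtain ⟨q, hq, hq'⟩ : ∃ q, j ≡ l [MOD 2 ^ q] ∧ ¬ j ≡ l [MOD 2 ^ (q + 1)] := by
    have hpos : Nat.find hex ≠ 0 := fun h => by
      have := Nat.find_spec hex
      rw [h] at this
      exact this (Nat.modEq_one)
    obtain ⟨q, hq⟩ := Nat.exists_eq_succ_of_ne_zero hpos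
    exact ⟨q, not_not.1 (Nat.find_min hex (hq ▸ Nat.lt_succ_self q)), by
      have := Nat.find_spec hex
      rwa [hq] at this⟩
  exact ⟨q, hq', fun h => Set.disjoint_left.1 hAB (hA.mem_of_modEq hj h hq.symm) hl,
    fun h => Set.disjoint_left.1 hAB hj (hB.mem_of_modEq hl h hq)⟩

/-- The image of `P₂` together with all partial bijections having a single point as domain. -/
def IsPolyOrSingle (f : ℕ ≃. ℕ) : Prop :=
  (∃ p, polyRep p = f) ∨ ∃ i j, PEquiv.single i j = f

theorem isPolyOrSingle_bot : IsPolyOrSingle ⊥ := Or.inl ⟨none, rfl⟩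

theorem IsPolyOrSingle.symm {f : ℕ ≃. ℕ} (hf : IsPolyOrSingle f) : IsPolyOrSingle f.symm := by
  rcases hf with ⟨p, rfl⟩ | ⟨i, j, rfl⟩
  · exact Or.inl ⟨p⁻¹, polyRep_inv p⟩
  · exact Or.inr ⟨j, i, (PEquiv.symm_single i j).symm⟩

theorem isPolyOrSingle_single_trans (i j : ℕ) (g : ℕ ≃. ℕ) :
    IsPolyOrSingle ((PEquiv.single i j).trans g) := by
  rcases h : g j with _ | k
  · rw [PEquiv.single_trans_of_eq_none _ h]
    exact isPolyOrSingle_bot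
  · rw [PEquiv.single_trans_of_mem _ h]
    exact Or.inr ⟨i, k, rfl⟩

theorem IsPolyOrSingle.trans {f g : ℕ ≃. ℕ} (hf : IsPolyOrSingle f) (hg : IsPolyOrSingle g) :
    IsPolyOrSingle (f.trans g) := by
  rcases hf with ⟨p, rfl⟩ | ⟨i, j, rfl⟩
  · rcases hg with ⟨q, rfl⟩ | ⟨i, j, rfl⟩
    · exact Or.inl ⟨p * q, polyRep_mul p q⟩
    · have := (isPolyOrSingle_single_trans j i (polyRep p).symm).symm
      rwa [PEquiv.symm_trans_rev, PEquiv.symm_single, PEquiv.symm_symm] at this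
  · exact isPolyOrSingle_single_trans i j g

theorem IsPolyOrSingle.isDyadic_domain {f : ℕ ≃. ℕ} (hf : IsPolyOrSingle f) :
    IsDyadic f.domain := by
  rcases hf with ⟨_ | ⟨a, b⟩, rfl⟩ | ⟨i, j, rfl⟩
  · convert isDyadic_empty
    ext x
    simp [PEquiv.domain, polyRep]
  · exact domain_polyRep a b ▸ isDyadic_range_wordAct a
  · convert isDyadic_singleton i
    ext x
    simp only [PEquiv.mem_domain, PEquiv.mem_single_iff, Set.mem_singleton_iff, exists_and_left,
      exists_eq, and_true]

/-- The topological inverse monoid in which `P₂` is dense and discrete. -/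
@[ext]
structure PolyCompletion : Type where
  /-- The underlying partial bijection. -/
  val : ℕ ≃. ℕ
  property : IsPolyOrSingle val

namespace PolyCompletion

instance : Inv PolyCompletion := ⟨fun s => ⟨s.1.symm, s.2.symm⟩⟩

noncomputable instance : Monoid PolyCompletion where
  mul s t := ⟨s.1.trans t.1, s.2.trans t.2⟩
  one := ⟨PEquiv.refl ℕ, Or.inl ⟨1, polyRep_one⟩⟩
  mul_assoc s t u := PolyCompletion.ext (PEquiv.trans_assoc _ _ _)
  one_mul s := PolyCompletion.ext (PEquiv.refl_trans _)
  mul_one s := PolyCompletion.ext (PEquiv.trans_refl _)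

theorem val_mul (s t : PolyCompletion) : (s * t).1 = s.1.trans t.1 := rfl

theorem val_inv (s : PolyCompletion) : s⁻¹.1 = s.1.symm := rfl

theorem mul_inv_mul (s : PolyCompletion) : s * s⁻¹ * s = s := by
  refine PolyCompletion.ext (PEquiv.ext_mem fun x y => ?_)
  simp only [val_mul, val_inv, PEquiv.mem_trans, PEquiv.mem_iff_mem]
  constructor
  · rintro ⟨z, ⟨w, hw, hw'⟩, hz⟩
    obtain rfl := s.1.inj hw hw'
    exact hz
  · exact fun h => ⟨x, ⟨y, h, h⟩, h⟩

theorem inv_mul_inv (s : PolyCompletion) : s⁻¹ * s * s⁻¹ = s⁻¹ := mul_inv_mul s⁻¹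

theorem inv_unique (s t : PolyCompletion) (h : s * t * s = s) (h' : t * s * t = t) :
    t = s⁻¹ := by
  have key : ∀ s t : PolyCompletion, s * t * s = s → ∀ x y, y ∈ s.1 x → x ∈ t.1 y := by
    intro s t h x y hy
    have hy' := hy
    rw [← h] at hy'
    simp only [val_mul, PEquiv.mem_trans] at hy'
    obtain ⟨z, ⟨w, hw, hw'⟩, hz⟩ := hy'
    obtain rfl := Option.mem_unique hy hw
    obtain rfl := s.1.inj hy hz
    exact hw'
  refine PolyCompletion.ext (PEquiv.ext_mem fun x y => ?_)
  rw [val_inv, PEquiv.mem_iff_mem]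
  exact ⟨key t s h' x y, key s t h y x⟩

open Classical in
/-- The coordinates defining the topology: the values of a partial bijection, the values of its
inverse, and whether it is zero. -/
noncomputable def coords (s : PolyCompletion) : (ℕ → ℕ) × (ℕ → ℕ) × Bool :=
  (fun x => Encodable.encode (s.1 x), fun x => Encodable.encode (s.1.symm x), decide (s.1 = ⊥))

noncomputable instance : TopologicalSpace PolyCompletion :=
  TopologicalSpace.induced coords inferInstance

theorem coords_injective : Function.Injective coords := by
  intro s t h
  refine PolyCompletion.ext (PEquiv.ext fun x => Encodable.encode_injective ?_)
  exact congrFun (congrArg Prod.fst h) x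

instance : T2Space PolyCompletion :=
  T2Space.of_injective_continuous coords_injective continuous_induced_dom

theorem tendsto_nhds_iff {α : Type*} {l : Filter α} {g : α → PolyCompletion}
    {s : PolyCompletion} : Tendsto g l (𝓝 s) ↔
      (∀ x, ∀ᶠ i in l, (g i).1 x = s.1 x) ∧ (∀ x, ∀ᶠ i in l, (g i).1.symm x = s.1.symm x) ∧
        ∀ᶠ i in l, ((g i).1 = ⊥ ↔ s.1 = ⊥) := by
  rw [nhds_induced, tendsto_comap_iff, Prod.tendsto_iff, Prod.tendsto_iff, tendsto_pi_nhds,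
    tendsto_pi_nhds]
  simp [coords, nhds_discrete, tendsto_pure]

theorem eventually_apply_eq (s : PolyCompletion) (x : ℕ) : ∀ᶠ t in 𝓝 s, t.1 x = s.1 x :=
  (tendsto_nhds_iff.1 tendsto_id).1 x

theorem eventually_symm_apply_eq (s : PolyCompletion) (x : ℕ) :
    ∀ᶠ t in 𝓝 s, t.1.symm x = s.1.symm x :=
  (tendsto_nhds_iff.1 tendsto_id).2.1 x

theorem eventually_eq_bot_iff (s : PolyCompletion) : ∀ᶠ t in 𝓝 s, (t.1 = ⊥ ↔ s.1 = ⊥) :=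
  (tendsto_nhds_iff.1 tendsto_id).2.2

theorem eventually_mem_domain_iff (s : PolyCompletion) (x : ℕ) :
    ∀ᶠ t in 𝓝 s, (x ∈ t.1.domain ↔ x ∈ s.1.domain) :=
  (eventually_apply_eq s x).mono fun t ht => by simp only [PEquiv.mem_domain, ht]

theorem eventually_mem_domain_symm_iff (s : PolyCompletion) (x : ℕ) :
    ∀ᶠ t in 𝓝 s, (x ∈ t.1.symm.domain ↔ x ∈ s.1.symm.domain) :=
  (eventually_symm_apply_eq s x).mono fun t ht => by
    simp only [PEquiv.mem_domain, ht]

instance : ContinuousInv PolyCompletion where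
  continuous_inv := continuous_iff_continuousAt.2 fun s => tendsto_nhds_iff.2
    ⟨eventually_symm_apply_eq s, eventually_apply_eq s, by
      filter_upwards [eventually_eq_bot_iff s] with t ht
      have key : ∀ f : ℕ ≃. ℕ, f.symm = ⊥ ↔ f = ⊥ := fun f =>
        ⟨fun h => by rw [← PEquiv.symm_symm f, h, PEquiv.symm_bot],
          fun h => by rw [h, PEquiv.symm_bot]⟩
      rw [val_inv, val_inv, key, key, ht]⟩

theorem trans_eq_bot_iff {f g : ℕ ≃. ℕ} :
    f.trans g = ⊥ ↔ Disjoint f.symm.domain g.domain := by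
  rw [Set.disjoint_left]
  constructor
  · rintro h z ⟨x, hx⟩ ⟨y, hy⟩
    have : y ∈ f.trans g x := (PEquiv.mem_trans _ _ _ _).2 ⟨z, (PEquiv.mem_iff_mem _).1 hx, hy⟩
    simp [h] at this
  · intro h
    refine PEquiv.ext fun x => Option.eq_none_iff_forall_not_mem.2 fun y hy => ?_
    obtain ⟨z, hz, hz'⟩ := (PEquiv.mem_trans _ _ _ _).1 hy
    exact h ⟨x, (PEquiv.mem_iff_mem _).2 hz⟩ ⟨y, hz'⟩

theorem domain_eq_empty_iff {f : ℕ ≃. ℕ} : f.domain = ∅ ↔ f = ⊥ := by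
  rw [← PEquiv.refl_trans f, trans_eq_bot_iff, PEquiv.refl_trans]
  have : (PEquiv.refl ℕ).symm.domain = Set.univ := by ext; simp [PEquiv.domain]
  rw [this, Set.univ_disjoint]

theorem eventually_mul_apply_eq (s t : PolyCompletion) (x : ℕ) :
    ∀ᶠ p in 𝓝 s ×ˢ 𝓝 t, (p.1 * p.2).1 x = (s * t).1 x := by
  change ∀ᶠ p in 𝓝 s ×ˢ 𝓝 t, (p.1.1 x).bind p.2.1 = (s.1 x).bind t.1
  rcases h : s.1 x with _ | y
  · filter_upwards [tendsto_fst.eventually (eventually_apply_eq s x)] with p hp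
    rw [hp, h]
    rfl
  · filter_upwards [tendsto_fst.eventually (eventually_apply_eq s x),
      tendsto_snd.eventually (eventually_apply_eq t y)] with p hp hp'
    rw [hp, h]
    exact hp'

theorem eventually_disjoint (s t : PolyCompletion)
    (h : Disjoint s.1.symm.domain t.1.domain) :
    ∀ᶠ p in 𝓝 s ×ˢ 𝓝 t, Disjoint p.1.1.symm.domain p.2.1.domain := by
  rcases s.1.symm.domain.eq_empty_or_nonempty with hs | ⟨j, hj⟩
  · have hs' : s.1 = ⊥ := by
      rw [← PEquiv.symm_symm s.1, domain_eq_empty_iff.1 hs, PEquiv.symm_bot]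
    filter_upwards [tendsto_fst.eventually (eventually_eq_bot_iff s)] with p hp
    rw [hp.2 hs', PEquiv.symm_bot, domain_eq_empty_iff.2 rfl]
    exact Set.empty_disjoint _
  rcases t.1.domain.eq_empty_or_nonempty with ht | ⟨l, hl⟩
  · filter_upwards [tendsto_snd.eventually (eventually_eq_bot_iff t)] with p hp
    rw [hp.2 (domain_eq_empty_iff.1 ht), domain_eq_empty_iff.2 rfl]
    exact Set.disjoint_empty _
  obtain ⟨q, hq, hjq, hlq⟩ :=
    s.2.symm.isDyadic_domain.exists_separation t.2.isDyadic_domain hj hl h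
  filter_upwards [tendsto_fst.eventually (eventually_mem_domain_symm_iff s j),
    tendsto_fst.eventually (eventually_mem_domain_symm_iff s (j + 2 ^ q)),
    tendsto_snd.eventually (eventually_mem_domain_iff t l),
    tendsto_snd.eventually (eventually_mem_domain_iff t (l + 2 ^ q))] with p h₁ h₂ h₃ h₄
  refine Set.disjoint_left.2 fun z hz hz' => hq ?_
  exact (p.1.2.symm.isDyadic_domain.modEq_of_notMem (h₁.2 hj) (mt h₂.1 hjq) hz).symm.trans
    (p.2.2.isDyadic_domain.modEq_of_notMem (h₃.2 hl) (mt h₄.1 hlq) hz')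

theorem eventually_not_disjoint (s t : PolyCompletion)
    (h : ¬ Disjoint s.1.symm.domain t.1.domain) :
    ∀ᶠ p in 𝓝 s ×ˢ 𝓝 t, ¬ Disjoint p.1.1.symm.domain p.2.1.domain := by
  obtain ⟨z, hz, hz'⟩ := Set.not_disjoint_iff.1 h
  filter_upwards [tendsto_fst.eventually (eventually_mem_domain_symm_iff s z),
    tendsto_snd.eventually (eventually_mem_domain_iff t z)] with p h₁ h₂
  exact Set.not_disjoint_iff.2 ⟨z, h₁.2 hz, h₂.2 hz'⟩

instance : ContinuousMul PolyCompletion where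
  continuous_mul := continuous_iff_continuousAt.2 fun ⟨s, t⟩ => by
    rw [ContinuousAt, nhds_prod_eq, tendsto_nhds_iff]
    refine ⟨eventually_mul_apply_eq s t, fun x => ?_, ?_⟩
    · have hinv := (continuous_inv (G := PolyCompletion)).tendsto
      have := (((hinv t).comp tendsto_snd).prodMk ((hinv s).comp tendsto_fst)).eventually
        (eventually_mul_apply_eq t⁻¹ s⁻¹ x)
      refine this.mono fun p hp => ?_
      simpa only [val_mul, val_inv, PEquiv.symm_trans_rev, Function.comp_apply] using hp
    · simp only [val_mul, trans_eq_bot_iff]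
      by_cases h : Disjoint s.1.symm.domain t.1.domain
      · exact (eventually_disjoint s t h).mono fun p hp => iff_of_true hp h
      · exact (eventually_not_disjoint s t h).mono fun p hp => iff_of_false hp h

/-- The embedding of `P₂`. -/
noncomputable def ofPoly (p : PolyMon (Fin 2)) : PolyCompletion := ⟨polyRep p, Or.inl ⟨p, rfl⟩⟩

theorem ofPoly_mul (p q : PolyMon (Fin 2)) : ofPoly (p * q) = ofPoly p * ofPoly q :=
  PolyCompletion.ext (polyRep_mul p q)

theorem ofPoly_inv (p : PolyMon (Fin 2)) : ofPoly p⁻¹ = (ofPoly p)⁻¹ :=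
  PolyCompletion.ext (polyRep_inv p)

theorem ofPoly_one : ofPoly 1 = 1 := PolyCompletion.ext polyRep_one

theorem ofPoly_injective : Function.Injective ofPoly := fun _ _ h =>
  polyRep_injective (congrArg val h)

theorem range_ofPoly_ne_univ : Set.range ofPoly ≠ Set.univ := by
  intro h
  obtain ⟨p, hp⟩ := h.superset (Set.mem_univ ⟨PEquiv.single 0 0, Or.inr ⟨0, 0, rfl⟩⟩)
  exact polyRep_ne_single p 0 0 (congrArg val hp)

theorem eventually_domain_eq {w : FreeMonoid (Fin 2)} {s : PolyCompletion}
    (hs : s.1.domain = Set.range (wordAct w)) :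
    ∀ᶠ t in 𝓝 s, t.1.domain = Set.range (wordAct w) := by
  have h₀ : wordAct w 0 ∈ s.1.domain := hs ▸ ⟨0, rfl⟩
  have h₁ : wordAct w 0 + 2 ^ w.length ∈ s.1.domain := by
    rw [hs, mem_range_wordAct]
    exact Nat.add_modEq_right
  have hsup : ∀ᶠ t in 𝓝 s, Set.range (wordAct w) ⊆ t.1.domain := by
    filter_upwards [eventually_mem_domain_iff s _, eventually_mem_domain_iff s _] with t ht₀ ht₁
    exact fun x hx =>
      t.2.isDyadic_domain.mem_of_modEq (ht₀.2 h₀) (ht₁.2 h₁) (mem_range_wordAct.1 hx)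
  have hsub : ∀ᶠ t in 𝓝 s, t.1.domain ⊆ Set.range (wordAct w) := by
    rcases h : w.length with _ | m
    · refine Eventually.of_forall fun t x _ => mem_range_wordAct.2 ?_
      rw [h]
      exact Nat.modEq_one
    · have h₂ : wordAct w 0 + 2 ^ m ∉ s.1.domain := by
        rw [hs, mem_range_wordAct, h]
        intro hmod
        have hd : 2 ^ (m + 1) ∣ 2 ^ m :=
          Nat.modEq_zero_iff_dvd.1 (Nat.ModEq.add_left_cancel' (wordAct w 0) hmod)
        have := (Nat.pow_dvd_pow_iff_le_right (le_refl 2)).1 hd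
        omega
      filter_upwards [eventually_mem_domain_iff s _, eventually_mem_domain_iff s _] with t ht₀ ht₂
      refine fun x hx => mem_range_wordAct.2 ?_
      rw [h]
      exact t.2.isDyadic_domain.modEq_of_notMem (ht₀.2 h₀) (mt ht₂.1 h₂) hx
  filter_upwards [hsup, hsub] with t h h' using h'.antisymm h

theorem eventually_ofPoly_eq (p : PolyMon (Fin 2)) :
    ∀ᶠ t in 𝓝 (ofPoly p), t ∈ Set.range ofPoly → t = ofPoly p := by
  rcases p with _ | ⟨a, b⟩
  · filter_upwards [eventually_eq_bot_iff (ofPoly none)] with t ht _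
    exact PolyCompletion.ext (ht.2 rfl)
  · have h₁ := eventually_domain_eq (s := ofPoly (polyEl a b)) (domain_polyRep a b)
    have h₂ := (continuous_inv.tendsto (ofPoly (polyEl a b))).eventually
      (eventually_domain_eq (w := b) (domain_polyRep_symm a b))
    filter_upwards [h₁, h₂]
    rintro _ ht₁ ht₂ ⟨_ | ⟨c, d⟩, rfl⟩
    · have : wordAct a 0 ∈ (ofPoly none).1.domain := ht₁ ▸ ⟨0, rfl⟩
      simp [ofPoly, polyRep, PEquiv.mem_domain] at this
    · rw [← eq_of_range_wordAct ((domain_polyRep c d).symm.trans ht₁),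
        ← eq_of_range_wordAct ((domain_polyRep_symm c d).symm.trans ht₂)]

theorem polyRep_apply_eq_single {a b : FreeMonoid (Fin 2)} {x : ℕ} (hx : x < 2 ^ a.length) :
    polyRep (polyEl a b) x = PEquiv.single (wordAct a 0) (wordAct b 0) x := by
  refine Option.ext fun y => ?_
  change y ∈ polyRep _ x ↔ y ∈ PEquiv.single _ _ x
  rw [mem_polyRep, PEquiv.mem_single_iff]
  constructor
  · rintro ⟨k, rfl, rfl⟩
    obtain rfl : k = 0 := by
      rw [wordAct_eq] at hx
      by_contra hk
      have := Nat.mul_le_mul_left (2 ^ a.length) (Nat.pos_of_ne_zero hk)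
      omega
    exact ⟨rfl, rfl⟩
  · rintro ⟨rfl, rfl⟩
    exact ⟨0, rfl, rfl⟩

theorem dense_range_ofPoly : Dense (Set.range ofPoly) := by
  rintro ⟨f, ⟨p, rfl⟩ | ⟨i, j, rfl⟩⟩
  · exact subset_closure ⟨p, rfl⟩
  · have hlt : ∀ n, n < 2 ^ (i + j + n) ∧ i < 2 ^ (i + j + n) ∧ j < 2 ^ (i + j + n) := fun n => by
      have : i + j + n < 2 ^ (i + j + n) := Nat.lt_two_pow_self
      omega
    choose a ha ha' using fun n => exists_wordAct_zero_eq (hlt n).2.1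
    choose b hb hb' using fun n => exists_wordAct_zero_eq (hlt n).2.2
    refine mem_closure_of_tendsto (f := fun n => ofPoly (polyEl (a n) (b n))) (b := atTop)
      (tendsto_nhds_iff.2 ⟨fun x => ?_, fun x => ?_, ?_⟩) (Eventually.of_forall fun n => ⟨_, rfl⟩)
    · filter_upwards [eventually_ge_atTop x] with n hn
      have := polyRep_apply_eq_single (a := a n) (b := b n) (ha n ▸ hn.trans_lt (hlt n).1)
      rwa [ha', hb'] at this
    · filter_upwards [eventually_ge_atTop x] with n hn
      have := polyRep_apply_eq_single (a := b n) (b := a n) (hb n ▸ hn.trans_lt (hlt n).1)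
      rw [ha', hb', ← PEquiv.symm_single] at this
      rw [← this]
      exact congrArg (fun f : ℕ ≃. ℕ => f x) (polyRep_inv (polyEl (a n) (b n))).symm
    · refine Eventually.of_forall fun n => iff_of_false (polyRep_polyEl_ne_bot _ _) fun h => ?_
      have := PEquiv.mem_single i j
      simp [show PEquiv.single i j = ⊥ from h] at this

theorem containsDenseDiscreteP2 : ContainsDenseDiscreteP2 PolyCompletion := by
  refine ⟨inferInstance, inferInstance, inferInstance, mul_inv_mul, inv_mul_inv, inv_unique,
    ofPoly, ofPoly_injective, ofPoly_mul, ofPoly_inv, ofPoly_one, range_ofPoly_ne_univ,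
    dense_range_ofPoly, ?_⟩
  rintro _ ⟨p, rfl⟩
  obtain ⟨U, hU, hUo, hpU⟩ := eventually_nhds_iff.1 (eventually_ofPoly_eq p)
  refine ⟨U, hUo, Set.Subset.antisymm (fun t ht => hU t ht.1 ht.2) ?_⟩
  rintro _ rfl
  exact ⟨hpU, p, rfl⟩

end PolyCompletion

theorem ContainsDenseDiscreteP2.not_isHClosedTIS {S : Type} [Monoid S] [Inv S]
    [TopologicalSpace S] (h : ContainsDenseDiscreteP2 S) :
    ¬ @IsHClosedTIS.{0, 0} (PolyMon (Fin 2)) _ ⊥ := by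
  obtain ⟨hT2, hmul, hinv, h₁, h₂, h₃, f, hf, hfmul, -, -, hne, hdense, hdisc⟩ := h
  intro hclosed
  let _ : InverseSemigroup S :=
    { mul_inv_mul := h₁, inv_mul_inv := h₂, inv_unique := h₃ }
  let _ : TopologicalSpace (PolyMon (Fin 2)) := ⊥
  have : ContinuousMul S := hmul
  have : ContinuousInv S := hinv
  refine hne ((hclosed S f hf ⟨?_⟩ hfmul).closure_eq.symm.trans hdense.closure_eq)
  refine (eq_bot_of_singletons_open fun p => ?_).symm
  obtain ⟨U, hU, hUp⟩ := hdisc (f p) ⟨p, rfl⟩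
  refine isOpen_induced_iff.2 ⟨U, hU, ?_⟩
  rw [← Set.preimage_inter_range, hUp, ← Set.image_singleton, hf.preimage_image]

/-- There exists a topological inverse monoid containing the polycyclic monoid `P₂` as a
proper dense discrete inverse submonoid; consequently `P₂` with the discrete topology is
not H-closed in the class of topological inverse semigroups. -/
theorem statement_17 :
    (∃ (S : Type) (iM : Monoid S) (iI : Inv S) (tS : TopologicalSpace S),
      @ContainsDenseDiscreteP2 S iM iI tS) ∧
    ¬ @IsHClosedTIS.{0, 0} (PolyMon (Fin 2)) _ ⊥ := by
  exact ⟨⟨PolyCompletion, inferInstance, inferInstance, inferInstance,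
      PolyCompletion.containsDenseDiscreteP2⟩,
    PolyCompletion.containsDenseDiscreteP2.not_isHClosedTIS⟩
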